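/- Let G be a finite loopless multigraph. There is a proper edge-coloring φ : E(G) → ℕ such that for every edge e with endpoints x and y, φ(e) ∈ {1, …, max{deg(x) + μ(x), deg(y) + μ(y)}}. -/

import Mathlib

/-- The degree of a vertex `x` in the multigraph with edge-endpoints map `ends`:
the number of edges incident to `x`. -/
noncomputable def multideg {V E : Type} (ends : E → Sym2 V) (x : V) : ℕ :=
  Nat.card {e : E // x ∈ ends e}

/-- `μ(x,y)`: the number of edges between `x` and `y`. -/
noncomputable def edgeMultiplicity {V E : Type} (ends : E → Sym2 V) (x y : V) : ℕ :=
  Nat.card {e : E // ends e = s(x, y)}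

/-- `μ(x) = max_z μ(x,z)`: the maximum multiplicity at `x`. -/
noncomputable def maxMultiplicity {V E : Type} [Fintype V] (ends : E → Sym2 V) (x : V) : ℕ :=
  Finset.univ.sup (fun z : V => edgeMultiplicity ends x z)

/-- A proper edge-coloring: distinct edges sharing an endpoint get distinct colors. -/
def IsProperEdgeColoring {V E : Type} (ends : E → Sym2 V) (φ : E → ℕ) : Prop :=
  ∀ e f : E, e ≠ f → (∃ v : V, v ∈ ends e ∧ v ∈ ends f) → φ e ≠ φ f

open Classical in
/-- In a finite graph of maximum degree at most two, a connected component has at most two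
vertices of degree at most one. -/
theorem SimpleGraph.not_reachable_of_three_ends {V : Type} [Fintype V] (G : SimpleGraph V)
    (hdeg : ∀ v, G.degree v ≤ 2) {a b c : V} (ha : G.degree a ≤ 1) (hb : G.degree b ≤ 1)
    (hc : G.degree c ≤ 1) (hab : a ≠ b) (hac : a ≠ c) (hbc : b ≠ c) (rab : G.Reachable a b) :
    ¬ G.Reachable a c := by
  intro rac
  let C := G.connectedComponentMk a
  have hconn : (G.induce C.supp).Connected := C.connected_toSimpleGraph
  have hcard := hconn.card_vert_le_card_edgeSet_add_one
  rw [Nat.card_eq_fintype_card, Nat.card_eq_fintype_card, ← SimpleGraph.edgeFinset_card] at hcard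
  have hsum := (G.induce C.supp).sum_degrees_eq_twice_card_edges
  have hd : ∀ v : C.supp, (G.induce C.supp).degree v = G.degree v := by
    intro v
    refine SimpleGraph.degree_induce_of_neighborSet_subset fun w hw => ?_
    exact C.mem_supp_of_adj_mem_supp v.2 hw
  let ends : Finset C.supp :=
    {⟨a, rfl⟩, ⟨b, SimpleGraph.ConnectedComponent.sound rab.symm⟩,
      ⟨c, SimpleGraph.ConnectedComponent.sound rac.symm⟩}
  have hends : ends.card = 3 := by
    rw [Finset.card_eq_three]
    exact ⟨_, _, _, fun h => hab (congrArg Subtype.val h), fun h => hac (congrArg Subtype.val h),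
      fun h => hbc (congrArg Subtype.val h), rfl⟩
  have hbound : ∑ v : C.supp, ((G.induce C.supp).degree v + if v ∈ ends then 1 else 0)
      ≤ ∑ _v : C.supp, 2 := by
    refine Finset.sum_le_sum fun v _ => ?_
    rw [hd]
    split_ifs with hv
    · simp only [ends, Finset.mem_insert, Finset.mem_singleton] at hv
      rcases hv with rfl | rfl | rfl <;> simpa
    · exact hdeg v
  simp only [Finset.sum_add_distrib, hsum, Finset.sum_ite_mem, Finset.univ_inter,
    Finset.sum_const, smul_eq_mul, hends, mul_one, Finset.card_univ] at hbound
  omega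

namespace LocalVizing

variable {V E : Type}

/-- The edges in `M` cover the vertex `v`. -/
def Covers (ends : E → Sym2 V) (M : Set E) (v : V) : Prop :=
  ∃ e ∈ M, v ∈ ends e

/-- The edges in `M` are pairwise disjoint. -/
def IsMatching (ends : E → Sym2 V) (M : Set E) : Prop :=
  ∀ e ∈ M, ∀ e' ∈ M, ∀ v, v ∈ ends e → v ∈ ends e' → e = e'

/-- The simple graph underlying the union of two sets of edges. -/
def unionGraph (ends : E → Sym2 V) (M N : Set E) : SimpleGraph V where
  Adj u w := u ≠ w ∧ ∃ e, (e ∈ M ∨ e ∈ N) ∧ ends e = s(u, w)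
  symm := ⟨fun _ _ ⟨h, e, he, hs⟩ => ⟨h.symm, e, he, hs.trans Sym2.eq_swap⟩⟩
  loopless := ⟨fun _ h => h.1 rfl⟩

theorem unionGraph_mono {ends : E → Sym2 V} {M M' N N' : Set E} (hM : M ⊆ M') (hN : N ⊆ N') :
    unionGraph ends M N ≤ unionGraph ends M' N' :=
  fun _ _ ⟨h, e, he, hs⟩ => ⟨h, e, he.imp (@hM e) (@hN e), hs⟩

open Classical in
theorem degree_unionGraph_le [Fintype V] {ends : E → Sym2 V} {M N : Set E}
    (hM : IsMatching ends M) (hN : IsMatching ends N) (v : V) :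
    (unionGraph ends M N).degree v ≤
      (if Covers ends M v then 1 else 0) + (if Covers ends N v then 1 else 0) := by
  have key : ∀ M : Set E, IsMatching ends M →
      (Finset.univ.filter fun w => ∃ e ∈ M, ends e = s(v, w)).card ≤
        if Covers ends M v then 1 else 0 := by
    intro M hM
    split_ifs with hc
    · rw [Finset.card_le_one]
      simp only [Finset.mem_filter, Finset.mem_univ, true_and]
      rintro w ⟨e, he, hs⟩ w' ⟨e', he', hs'⟩
      have := hM e he e' he' v (by simp [hs]) (by simp [hs'])
      subst this
      exact Sym2.congr_right.1 (hs.symm.trans hs')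
    · rw [Nat.le_zero, Finset.card_eq_zero, Finset.filter_eq_empty_iff]
      rintro w - ⟨e, he, hs⟩
      exact hc ⟨e, he, by simp [hs]⟩
  refine le_trans ?_ (Nat.add_le_add (key M hM) (key N hN))
  rw [← SimpleGraph.card_neighborFinset_eq_degree]
  refine (Finset.card_le_card ?_).trans (Finset.card_union_le _ _)
  intro w hw
  rw [SimpleGraph.mem_neighborFinset] at hw
  obtain ⟨-, e, he, hs⟩ := hw
  simp only [Finset.mem_union, Finset.mem_filter, Finset.mem_univ, true_and]
  exact he.imp (fun h => ⟨e, h, hs⟩) (fun h => ⟨e, h, hs⟩)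

theorem unionGraph_not_reachable [Fintype V] {ends : E → Sym2 V} {M N : Set E}
    (hM : IsMatching ends M) (hN : IsMatching ends N) {a b c : V}
    (ha : ¬ (Covers ends M a ∧ Covers ends N a)) (hb : ¬ (Covers ends M b ∧ Covers ends N b))
    (hc : ¬ (Covers ends M c ∧ Covers ends N c)) (hab : a ≠ b) (hac : a ≠ c) (hbc : b ≠ c)
    (rab : (unionGraph ends M N).Reachable a b) : ¬ (unionGraph ends M N).Reachable a c := by
  classical
  have hd := degree_unionGraph_le hM hN
  have hd' : ∀ v, ¬ (Covers ends M v ∧ Covers ends N v) →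
      (unionGraph ends M N).degree v ≤ 1 := by
    intro v hv
    refine (hd v).trans ?_
    split_ifs <;> simp_all
  refine SimpleGraph.not_reachable_of_three_ends _ (fun v => (hd v).trans ?_) (hd' a ha)
    (hd' b hb) (hd' c hc) hab hac hbc rab
  split_ifs <;> simp

theorem covers_of_reachable {ends : E → Sym2 V} {M N : Set E} {u v : V} (huv : u ≠ v)
    (h : (unionGraph ends M N).Reachable u v) : ∃ e, (e ∈ M ∨ e ∈ N) ∧ v ∈ ends e := by
  rw [SimpleGraph.reachable_iff_reflTransGen] at h
  rcases h.cases_tail with rfl | ⟨w, -, -, e, he, hs⟩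
  · exact absurd rfl huv
  · exact ⟨e, he, by simp [hs]⟩

theorem mem_ends_of_reachable {ends : E → Sym2 V} {M N : Set E} {u v w : V} {e : E}
    (he : e ∈ M ∨ e ∈ N) (hv : v ∈ ends e) (hw : w ∈ ends e)
    (h : (unionGraph ends M N).Reachable u v) : (unionGraph ends M N).Reachable u w := by
  by_cases hvw : v = w
  · exact hvw ▸ h
  · exact h.trans (SimpleGraph.Adj.reachable ⟨hvw, e, he, (Sym2.mem_and_mem_iff hvw).1 ⟨hv, hw⟩⟩)

/-- If `x` is isolated in `M ∪ N`, then all vertices joined to `x` after adding an edge `s(x, u)`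
are already joined to `u`. -/
theorem reachable_of_insert {ends : E → Sym2 V} {M N : Set E} {e : E} {x u w : V}
    (he : ends e = s(x, u)) (hM : ¬ Covers ends M x) (hN : ¬ Covers ends N x) (hw : w ≠ x)
    (h : (unionGraph ends M (insert e N)).Reachable x w) :
    (unionGraph ends M N).Reachable u w := by
  rw [SimpleGraph.reachable_iff_reflTransGen] at h
  suffices H : w = x ∨ (unionGraph ends M N).Reachable u w from H.resolve_left hw
  clear hw
  induction h with
  | refl => exact Or.inl rfl
  | @tail b c _ hbc ih =>
    obtain ⟨hne, f, hf, hs⟩ := hbc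
    rw [Set.mem_insert_iff, or_left_comm] at hf
    rcases hf with rfl | hf
    · rw [he, Sym2.eq_iff] at hs
      rcases hs with ⟨rfl, rfl⟩ | ⟨rfl, rfl⟩
      · exact Or.inr (SimpleGraph.Reachable.refl _)
      · exact Or.inl rfl
    · rcases ih with rfl | ih
      · exfalso
        rcases hf with hf | hf
        · exact hM ⟨f, hf, by simp [hs]⟩
        · exact hN ⟨f, hf, by simp [hs]⟩
      · exact Or.inr (mem_ends_of_reachable hf (by simp [hs]) (by simp [hs]) ih)

/-- A partial proper edge-coloring in which every edge has a positive color not exceeding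
the bound `f` at one of its endpoints. -/
structure IsPartialColoring (ends : E → Sym2 V) (f : V → ℕ) (φ : E → Option ℕ) : Prop where
  proper : ∀ e e' v c, v ∈ ends e → v ∈ ends e' → φ e = some c → φ e' = some c → e = e'
  pos : ∀ e c, φ e = some c → 1 ≤ c
  bound : ∀ e c, φ e = some c → ∃ v ∈ ends e, c ≤ f v

/-- Some edge at `v` has color `c`. -/
def Sees (ends : E → Sym2 V) (φ : E → Option ℕ) (v : V) (c : ℕ) : Prop :=
  Covers ends {e | φ e = some c} v

/-- The color `c` is available at `v`: it lies in `[1, f v]` and no edge at `v` uses it. -/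
def Missing (ends : E → Sym2 V) (f : V → ℕ) (φ : E → Option ℕ) (v : V) (c : ℕ) : Prop :=
  1 ≤ c ∧ c ≤ f v ∧ ¬ Sees ends φ v c

/-- The uncolored edges. -/
def uncolored (φ : E → Option ℕ) : Set E := {e | φ e = none}

/-- The pairs of a vertex and a color above its bound that appears at it. -/
def excess (ends : E → Sym2 V) (f : V → ℕ) (φ : E → Option ℕ) : Set (V × ℕ) :=
  {p | f p.1 < p.2 ∧ Sees ends φ p.1 p.2}

/-- A partial coloring with the fewest uncolored edges and, among those, the smallest excess. -/
structure IsOptimal (ends : E → Sym2 V) (f : V → ℕ) (φ : E → Option ℕ) : Prop where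
  isPartialColoring : IsPartialColoring ends f φ
  le : ∀ ψ, IsPartialColoring ends f ψ → (uncolored ψ).ncard ≤ (uncolored φ).ncard →
    (uncolored φ).ncard ≤ (uncolored ψ).ncard ∧
      (excess ends f φ).ncard ≤ (excess ends f ψ).ncard

theorem exists_isOptimal (ends : E → Sym2 V) (f : V → ℕ) : ∃ φ, IsOptimal ends f φ := by
  obtain ⟨φ₁, h₁, hmin₁⟩ := (measure fun φ : E → Option ℕ => (uncolored φ).ncard).wf.has_min
    {φ | IsPartialColoring ends f φ}
    ⟨fun _ => none, by simp, by simp, by simp⟩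
  obtain ⟨φ₂, ⟨h₂, h₂'⟩, hmin₂⟩ :=
    (measure fun φ : E → Option ℕ => (excess ends f φ).ncard).wf.has_min
      {φ | IsPartialColoring ends f φ ∧ (uncolored φ).ncard ≤ (uncolored φ₁).ncard} ⟨φ₁, h₁, le_rfl⟩
  refine ⟨φ₂, h₂, fun ψ hψ hle => ?_⟩
  exact ⟨h₂'.trans (not_lt.1 (hmin₁ ψ hψ)), not_lt.1 (hmin₂ ψ ⟨hψ, hle.trans h₂'⟩)⟩

theorem IsOptimal.of_le {ends : E → Sym2 V} {f : V → ℕ} {φ ψ : E → Option ℕ}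
    (h : IsOptimal ends f φ) (hψ : IsPartialColoring ends f ψ)
    (hu : (uncolored ψ).ncard ≤ (uncolored φ).ncard)
    (he : (excess ends f ψ).ncard ≤ (excess ends f φ).ncard) : IsOptimal ends f ψ :=
  ⟨hψ, fun χ hχ hle =>
    ⟨hu.trans (h.le χ hχ (hle.trans hu)).1, he.trans (h.le χ hχ (hle.trans hu)).2⟩⟩

theorem finite_excess [Finite V] [Finite E] (ends : E → Sym2 V) (f : V → ℕ) (φ : E → Option ℕ) :
    (excess ends f φ).Finite := by
  refine (Set.finite_range fun p : V × E => (p.1, (φ p.2).getD 0)).subset ?_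
  rintro ⟨v, c⟩ ⟨-, e, he, -⟩
  exact ⟨(v, e), by simp [show φ e = some c from he]⟩

theorem IsPartialColoring.isMatching {ends : E → Sym2 V} {f : V → ℕ} {φ : E → Option ℕ}
    (h : IsPartialColoring ends f φ) {c : ℕ} {M : Set E} (hM : M ⊆ {e | φ e = some c}) :
    IsMatching ends M :=
  fun e he e' he' v hv hv' => h.proper e e' v c hv hv' (hM he) (hM he')

open Classical in
theorem IsPartialColoring.update {ends : E → Sym2 V} {f : V → ℕ} {φ : E → Option ℕ}
    (h : IsPartialColoring ends f φ) {e : E} {c : ℕ} (hc : 1 ≤ c) (hb : ∃ v ∈ ends e, c ≤ f v)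
    (hs : ∀ v ∈ ends e, ¬ Sees ends φ v c) :
    IsPartialColoring ends f (Function.update φ e (some c)) where
  proper := by
    intro a a' v d hv hv' ha ha'
    simp only [Function.update_apply] at ha ha'
    split_ifs at ha ha' with h₁ h₂ h₂
    · exact h₁.trans h₂.symm
    · subst h₁; cases ha
      exact absurd ⟨a', ha', hv'⟩ (hs v hv)
    · subst h₂; cases ha'
      exact absurd ⟨a, ha, hv⟩ (hs v hv')
    · exact h.proper a a' v d hv hv' ha ha'
  pos := by
    intro a d ha
    simp only [Function.update_apply] at ha
    split_ifs at ha with h₁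
    · cases ha; exact hc
    · exact h.pos a d ha
  bound := by
    intro a d ha
    simp only [Function.update_apply] at ha
    split_ifs at ha with h₁
    · cases ha; exact h₁ ▸ hb
    · exact h.bound a d ha

theorem IsPartialColoring.mono {ends : E → Sym2 V} {f : V → ℕ} {φ ψ : E → Option ℕ}
    (h : IsPartialColoring ends f φ) (hψ : ∀ e c, ψ e = some c → φ e = some c) :
    IsPartialColoring ends f ψ where
  proper e e' v c hv hv' he he' := h.proper e e' v c hv hv' (hψ e c he) (hψ e' c he')
  pos e c he := h.pos e c (hψ e c he)
  bound e c he := h.bound e c (hψ e c he)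

/-- No color is available for an uncolored edge of an optimal coloring. -/
theorem IsOptimal.sees_of_missing [Finite E] {ends : E → Sym2 V} {f : V → ℕ}
    {φ : E → Option ℕ} (h : IsOptimal ends f φ) {g : E} {x z : V} (hg : φ g = none)
    (hs : ends g = s(x, z)) {c : ℕ} (hc : Missing ends f φ z c) : Sees ends φ x c := by
  classical
  by_contra hx
  have hψ : IsPartialColoring ends f (Function.update φ g (some c)) := by
    refine h.isPartialColoring.update hc.1 ⟨z, by simp [hs], hc.2.1⟩ fun v hv => ?_
    rw [hs, Sym2.mem_iff] at hv
    rcases hv with rfl | rfl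
    · exact hx
    · exact hc.2.2
  have hlt : (uncolored (Function.update φ g (some c))).ncard < (uncolored φ).ncard := by
    refine Set.ncard_lt_ncard ⟨fun e he => ?_, fun hsub => ?_⟩
    · simp only [uncolored, Set.mem_ofPred_eq, Function.update_apply] at he ⊢
      split_ifs at he; exact he
    · simpa [uncolored] using hsub hg
  exact absurd (h.le _ hψ hlt.le).1 (not_le.2 hlt)

open Classical in
/-- Uncolor the edge `a` at `x` in order to give its color to the uncolored edge `g` at `x`. -/
theorem IsOptimal.shift [Finite V] [Finite E] {ends : E → Sym2 V} {f : V → ℕ}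
    {φ : E → Option ℕ} (h : IsOptimal ends f φ) {g a : E} {x z : V} (hg : φ g = none)
    (hs : ends g = s(x, z)) {c : ℕ} (hc : Missing ends f φ z c) (hxa : x ∈ ends a)
    (ha : φ a = some c) :
    IsOptimal ends f (Function.update (Function.update φ a none) g (some c)) := by
  have hag : a ≠ g := by rintro rfl; simp [hg] at ha
  refine h.of_le ?_ ?_ (Set.ncard_le_ncard ?_ (finite_excess ends f φ))
  · refine (h.isPartialColoring.mono fun e d he => ?_).update hc.1 ⟨z, by simp [hs], hc.2.1⟩
      fun v hv => ?_
    · simp only [Function.update_apply] at he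
      split_ifs at he; exact he
    · rintro ⟨e, he, hve⟩
      simp only [Set.mem_ofPred_eq, Function.update_apply] at he
      split_ifs at he with hea
      rw [hs, Sym2.mem_iff] at hv
      rcases hv with rfl | rfl
      · exact hea (h.isPartialColoring.proper e a v c hve hxa he ha)
      · exact hc.2.2 ⟨e, he, hve⟩
  · have : uncolored (Function.update (Function.update φ a none) g (some c)) ⊆
        insert a (uncolored φ \ {g}) := by
      intro e he
      simp only [uncolored, Set.mem_ofPred_eq, Function.update_apply] at he
      split_ifs at he with h₁ h₂
      · exact Or.inl h₂
      · exact Or.inr ⟨he, h₁⟩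
    refine (Set.ncard_le_ncard this).trans ((Set.ncard_insert_le _ _).trans ?_)
    exact (Set.ncard_sdiff_singleton_add_one (show g ∈ uncolored φ from hg)).le
  · rintro ⟨v, d⟩ ⟨hlt, e, he, hve⟩
    refine ⟨hlt, ?_⟩
    simp only [Set.mem_ofPred_eq, Function.update_apply] at he
    split_ifs at he with h₁ h₂
    · subst h₁; cases he
      rw [hs, Sym2.mem_iff] at hve
      rcases hve with rfl | rfl
      · exact ⟨a, ha, hxa⟩
      · exact absurd hc.2.1 (not_le.2 hlt)
    · exact ⟨e, he, hve⟩

/-- Both colors `α` and `β` are permitted on the edge `e`. -/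
def Permits (ends : E → Sym2 V) (f : V → ℕ) (α β : ℕ) (e : E) : Prop :=
  (∃ v ∈ ends e, α ≤ f v) ∧ ∃ v ∈ ends e, β ≤ f v

/-- The edges of color `c` that may be recolored with either of `α` and `β`. -/
def swappable (ends : E → Sym2 V) (f : V → ℕ) (φ : E → Option ℕ) (α β c : ℕ) : Set E :=
  {e | φ e = some c ∧ Permits ends f α β e}

open Classical in
/-- Swap `α` and `β` on the edges meeting `C`, uncoloring those where this is not permitted. -/
noncomputable def swapOn (ends : E → Sym2 V) (f : V → ℕ) (φ : E → Option ℕ) (α β : ℕ)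
    (C : Set V) (e : E) : Option ℕ :=
  if ∃ v ∈ ends e, v ∈ C then
    if (φ e = some α ∨ φ e = some β) ∧ ¬ Permits ends f α β e then none
    else (φ e).map (Equiv.swap α β)
  else φ e

section Swap

variable {ends : E → Sym2 V} {f : V → ℕ} {φ : E → Option ℕ} {α β : ℕ} {C : Set V}

theorem eq_of_swapOn_of_mem {e : E} {v : V} {c : ℕ} (hv : v ∈ ends e) (hC : v ∈ C)
    (h : swapOn ends f φ α β C e = some c) : φ e = some (Equiv.swap α β c) := by
  unfold swapOn at h
  rw [if_pos ⟨v, hv, hC⟩] at h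
  split_ifs at h
  obtain ⟨d, hd, rfl⟩ := Option.map_eq_some_iff.1 h
  rw [hd, Equiv.swap_apply_self]

theorem permits_of_swapOn_of_mem {e : E} {v : V} {c : ℕ} (hv : v ∈ ends e) (hC : v ∈ C)
    (h : swapOn ends f φ α β C e = some c) (hφ : φ e = some α ∨ φ e = some β) :
    Permits ends f α β e := by
  unfold swapOn at h
  rw [if_pos ⟨v, hv, hC⟩] at h
  split_ifs at h with h'
  exact not_not.1 fun hp => h' ⟨hφ, hp⟩

/-- `C` is a union of components of the graph of swappable edges. -/
def IsClosed (ends : E → Sym2 V) (f : V → ℕ) (φ : E → Option ℕ) (α β : ℕ) (C : Set V) : Prop :=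
  ∀ e v w, (φ e = some α ∨ φ e = some β) → Permits ends f α β e → v ∈ ends e → w ∈ ends e →
    v ∈ C → w ∈ C

theorem eq_of_swapOn_of_notMem (hC : IsClosed ends f φ α β C) {e : E} {v : V} {c : ℕ}
    (hv : v ∈ ends e) (hvC : v ∉ C) (h : swapOn ends f φ α β C e = some c) : φ e = some c := by
  have h₀ := h
  unfold swapOn at h
  split_ifs at h with h₁ h₂
  · obtain ⟨w, hw, hwC⟩ := h₁
    obtain ⟨d, hd, rfl⟩ := Option.map_eq_some_iff.1 h
    rw [hd, Equiv.swap_apply_of_ne_of_ne]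
    · rintro rfl
      exact hvC (hC e w v (Or.inl hd) (permits_of_swapOn_of_mem hw hwC h₀ (Or.inl hd)) hw hv hwC)
    · rintro rfl
      exact hvC (hC e w v (Or.inr hd) (permits_of_swapOn_of_mem hw hwC h₀ (Or.inr hd)) hw hv hwC)
  · exact h

theorem swapOn_eq_some {e : E} {c : ℕ} (h : swapOn ends f φ α β C e = some c) :
    φ e = some c ∨ (c = α ∨ c = β) ∧ Permits ends f α β e := by
  by_cases h₁ : ∃ v ∈ ends e, v ∈ C
  · obtain ⟨v, hv, hvC⟩ := h₁
    have h₂ := eq_of_swapOn_of_mem hv hvC h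
    have h₃ := permits_of_swapOn_of_mem hv hvC h
    by_cases hα : c = α
    · subst hα
      rw [Equiv.swap_apply_left] at h₂
      exact Or.inr ⟨Or.inl rfl, h₃ (Or.inr h₂)⟩
    by_cases hβ : c = β
    · subst hβ
      rw [Equiv.swap_apply_right] at h₂
      exact Or.inr ⟨Or.inr rfl, h₃ (Or.inl h₂)⟩
    rw [Equiv.swap_apply_of_ne_of_ne hα hβ] at h₂
    exact Or.inl h₂
  · unfold swapOn at h
    rw [if_neg h₁] at h
    exact Or.inl h

theorem swapOn_eq_none {e : E} (h : swapOn ends f φ α β C e = none) :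
    φ e = none ∨ (∃ v ∈ ends e, v ∈ C) ∧ (φ e = some α ∨ φ e = some β) ∧
      ¬ Permits ends f α β e := by
  unfold swapOn at h
  split_ifs at h with h₁ h₂
  · exact Or.inr ⟨h₁, h₂⟩
  · exact Or.inl (Option.map_eq_none_iff.1 h)
  · exact Or.inl h

theorem IsPartialColoring.swapOn (h : IsPartialColoring ends f φ) (hC : IsClosed ends f φ α β C)
    (hα : 1 ≤ α) (hβ : 1 ≤ β) : IsPartialColoring ends f (swapOn ends f φ α β C) where
  proper e e' v c hv hv' he he' := by
    by_cases hvC : v ∈ C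
    · exact h.proper e e' v _ hv hv' (eq_of_swapOn_of_mem hv hvC he)
        (eq_of_swapOn_of_mem hv' hvC he')
    · exact h.proper e e' v _ hv hv' (eq_of_swapOn_of_notMem hC hv hvC he)
        (eq_of_swapOn_of_notMem hC hv' hvC he')
  pos e c he := by
    rcases swapOn_eq_some he with h₁ | ⟨rfl | rfl, -⟩
    · exact h.pos e c h₁
    · exact hα
    · exact hβ
  bound e c he := by
    rcases swapOn_eq_some he with h₁ | ⟨rfl | rfl, h₁⟩
    · exact h.bound e c h₁
    · exact h₁.1
    · exact h₁.2

end Swap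

/-- The Kempe chain through the end of an uncolored edge of an optimal coloring, in a color
missing there and a color missing at the other end, joins the two ends. -/
theorem IsOptimal.reachable [Fintype V] [Finite E] {ends : E → Sym2 V} {f : V → ℕ}
    {φ : E → Option ℕ} (h : IsOptimal ends f φ) {g : E} {x z : V} (hg : φ g = none)
    (hs : ends g = s(x, z)) {α β : ℕ} (hx : Missing ends f φ x α) (hz : Missing ends f φ z β) :
    (unionGraph ends {e | φ e = some α} {e | φ e = some β}).Reachable x z := by
  classical
  by_contra hxz
  have hp := h.isPartialColoring
  have hzα : Sees ends φ z α := h.sees_of_missing hg (hs.trans Sym2.eq_swap) hx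
  have hne : α ≠ β := by rintro rfl; exact hz.2.2 hzα
  let M := swappable ends f φ α β α
  let N := swappable ends f φ α β β
  have hM : IsMatching ends M := hp.isMatching fun e he => he.1
  have hN : IsMatching ends N := hp.isMatching fun e he => he.1
  let C : Set V := {v | (unionGraph ends M N).Reachable z v}
  have hzC : z ∈ C := SimpleGraph.Reachable.refl z
  have hxC : x ∉ C := fun hr =>
    hxz (SimpleGraph.Reachable.mono (unionGraph_mono (fun e he => he.1) (fun e he => he.1))
      (SimpleGraph.Reachable.symm hr))
  have hC : IsClosed ends f φ α β C := fun e v w he hperm hv hw hvC =>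
    mem_ends_of_reachable (he.imp (fun he => ⟨he, hperm⟩) (fun he => ⟨he, hperm⟩)) hv hw hvC
  let ψ : E → Option ℕ := Function.update (swapOn ends f φ α β C) g (some α)
  have hψg : ψ g = some α := Function.update_self ..
  have hψne : ∀ e, e ≠ g → ψ e = swapOn ends f φ α β C e :=
    fun e he => Function.update_of_ne he ..
  have hψ : IsPartialColoring ends f ψ := by
    refine (hp.swapOn hC hx.1 hz.1).update hx.1 ⟨x, by simp [hs], hx.2.1⟩ fun v hv => ?_
    rintro ⟨e, he, hve⟩
    rw [hs, Sym2.mem_iff] at hv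
    rcases hv with rfl | rfl
    · exact hx.2.2 ⟨e, eq_of_swapOn_of_notMem hC hve hxC he, hve⟩
    · refine hz.2.2 ⟨e, ?_, hve⟩
      simpa using eq_of_swapOn_of_mem hve hzC he
  have hunc : ∀ e, ψ e = none → e ∈ uncolored φ \ {g} ∨
      (∃ v ∈ ends e, v ∈ C) ∧ (φ e = some α ∨ φ e = some β) ∧ ¬ Permits ends f α β e := by
    intro e he
    have heg : e ≠ g := by rintro rfl; simp [hψg] at he
    rw [hψne e heg] at he
    exact (swapOn_eq_none he).imp_left fun h₁ => ⟨h₁, heg⟩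
  have hcard := Set.ncard_sdiff_singleton_add_one (show g ∈ uncolored φ from hg)
  have hzend : ¬ (Covers ends M z ∧ Covers ends N z) := fun hcov => by
    obtain ⟨-, e, he, hv⟩ := hcov
    exact hz.2.2 ⟨e, he.1, hv⟩
  have hyz : ∀ e y, (φ e = some α ∨ φ e = some β) → ¬ Permits ends f α β e → y ∈ ends e →
      y ≠ z := by
    rintro e y (he | he) hperm hy rfl
    · exact hperm ⟨hp.bound e α he, y, hy, hz.2.1⟩
    · exact hz.2.2 ⟨e, he, hy⟩
  have hyend : ∀ e y, (φ e = some α ∨ φ e = some β) → ¬ Permits ends f α β e → y ∈ ends e →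
      ¬ (Covers ends M y ∧ Covers ends N y) := by
    rintro e y he hperm hy ⟨⟨a, ha, hya⟩, ⟨b, hb, hyb⟩⟩
    rcases he with he | he
    · exact hperm (hp.proper e a y α hy hya he ha.1 ▸ ha.2)
    · exact hperm (hp.proper e b y β hy hyb he hb.1 ▸ hb.2)
  by_cases hW : ∃ e y, (φ e = some α ∨ φ e = some β) ∧ ¬ Permits ends f α β e ∧
      y ∈ ends e ∧ y ∈ C
  swap
  · have hsub : uncolored ψ ⊆ uncolored φ \ {g} := fun e he =>
      (hunc e he).resolve_right fun ⟨⟨v, hv, hvC⟩, hcol, hperm⟩ =>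
        hW ⟨e, v, hcol, hperm, hv, hvC⟩
    have := Set.ncard_le_ncard hsub
    have := (h.le ψ hψ (by omega)).1
    omega
  obtain ⟨e, y, he, hperm, hy, hyC⟩ := hW
  have hmix : ∀ a b, φ a = some α → φ b = some β → ¬ Permits ends f α β a →
      ¬ Permits ends f α β b → False := by
    intro a b ha hb hpa hpb
    obtain ⟨u, hu, hαu⟩ := hp.bound a α ha
    obtain ⟨w, hw, hβw⟩ := hp.bound b β hb
    have h₁ : f u < β := not_le.1 fun hle => hpa ⟨⟨u, hu, hαu⟩, u, hu, hle⟩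
    have h₂ : f w < α := not_le.1 fun hle => hpb ⟨⟨w, hw, hle⟩, w, hw, hβw⟩
    omega
  have huniq : ∀ v ∈ C, v ≠ z → ¬ (Covers ends M v ∧ Covers ends N v) → v = y := by
    intro v hv hvz hvend
    by_contra hvy
    exact unionGraph_not_reachable hM hN hzend (hyend e y he hperm hy) hvend
      (hyz e y he hperm hy).symm (Ne.symm hvz) (Ne.symm hvy) hyC hv
  have hsub : uncolored ψ ⊆ insert e (uncolored φ \ {g}) := by
    intro a ha
    rcases hunc a ha with ha | ⟨⟨v, hv, hvC⟩, hcol, hperm'⟩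
    · exact Or.inr ha
    refine Or.inl ?_
    obtain rfl := huniq v hvC (hyz a v hcol hperm' hv) (hyend a v hcol hperm' hv)
    rcases he with he | he <;> rcases hcol with hcol | hcol
    · exact hp.proper a e v α hv hy hcol he
    · exact (hmix e a he hcol hperm hperm').elim
    · exact (hmix a e hcol he hperm' hperm).elim
    · exact hp.proper a e v β hv hy hcol he
  have hle : (uncolored ψ).ncard ≤ (uncolored φ).ncard := by
    have := Set.ncard_le_ncard hsub
    have := Set.ncard_insert_le e (uncolored φ \ {g})
    omega
  refine absurd (h.le ψ hψ hle).2 (not_le.2 (Set.ncard_lt_ncard ?_ (finite_excess ends f φ)))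
  have hyz' := hyz e y he hperm hy
  obtain ⟨b, hb, hyb⟩ := covers_of_reachable hyz'.symm hyC
  refine ⟨?_, fun hsup => ?_⟩
  · rintro ⟨v, d⟩ ⟨hlt, a, ha, hva⟩
    refine ⟨hlt, ?_⟩
    change f v < d at hlt
    change ψ a = some d at ha
    by_cases hag : a = g
    · subst hag
      rw [hψg, Option.some_inj] at ha
      subst ha
      rw [hs, Sym2.mem_iff] at hva
      rcases hva with rfl | rfl
      · exact absurd hx.2.1 (not_le.2 hlt)
      · exact hzα
    rw [hψne a hag] at ha
    by_cases hvC : v ∈ C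
    swap
    · exact ⟨a, eq_of_swapOn_of_notMem hC hva hvC ha, hva⟩
    have hφa := eq_of_swapOn_of_mem hva hvC ha
    have hpa := permits_of_swapOn_of_mem hva hvC ha
    by_cases hdα : d = α
    · subst hdα
      rw [Equiv.swap_apply_left] at hφa
      have hvz : v ≠ z := by rintro rfl; exact hz.2.2 ⟨a, hφa, hva⟩
      by_cases hvy : v = y
      · subst hvy
        rcases he with he | he
        · exact ⟨e, he, hy⟩
        · exact absurd (hp.proper a e v β hva hy hφa he ▸ hpa (Or.inr hφa)) hperm
      · obtain ⟨b', hb', hvb'⟩ := (not_not.1 fun hend => hvy (huniq v hvC hvz hend)).1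
        exact ⟨b', hb'.1, hvb'⟩
    by_cases hdβ : d = β
    · subst hdβ
      rw [Equiv.swap_apply_right] at hφa
      have hvz : v ≠ z := by rintro rfl; exact absurd hz.2.1 (not_le.2 hlt)
      by_cases hvy : v = y
      · subst hvy
        rcases he with he | he
        · exact absurd (hp.proper a e v α hva hy hφa he ▸ hpa (Or.inl hφa)) hperm
        · exact ⟨e, he, hy⟩
      · obtain ⟨b', hb', hvb'⟩ := (not_not.1 fun hend => hvy (huniq v hvC hvz hend)).2
        exact ⟨b', hb'.1, hvb'⟩
    rw [Equiv.swap_apply_of_ne_of_ne hdα hdβ] at hφa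
    exact ⟨a, hφa, hva⟩
  · have hexcess : ∀ d, φ e = some (Equiv.swap α β d) → (y, d) ∉ excess ends f ψ := by
      rintro d hed ⟨-, a, ha, hya⟩
      change ψ a = some d at ha
      have hag : a ≠ g := by
        rintro rfl
        change y ∈ ends a at hya
        rw [hs, Sym2.mem_iff] at hya
        exact hya.elim (fun hyx => hxC (hyx ▸ hyC)) hyz'
      rw [hψne a hag] at ha
      have hφa := eq_of_swapOn_of_mem hya hyC ha
      obtain rfl := hp.proper a e y _ hya hy hφa hed
      exact hperm (permits_of_swapOn_of_mem hya hyC ha he)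
    have hbe : b ≠ e := by
      rintro rfl
      exact hperm (hb.elim (fun hb => hb.2) (fun hb => hb.2))
    rcases he with he | he
    · refine hexcess β (by simpa using he) (hsup ⟨not_le.1 fun hle => ?_, b, ?_, hyb⟩)
      · exact hperm ⟨hp.bound e α he, y, hy, hle⟩
      · exact hb.elim (fun hb => absurd (hp.proper b e y α hyb hy hb.1 he) hbe) (fun hb => hb.1)
    · refine hexcess α (by simpa using he) (hsup ⟨not_le.1 fun hle => ?_, b, ?_, hyb⟩)
      · exact hperm ⟨⟨y, hy, hle⟩, hp.bound e β he⟩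
      · exact hb.elim (fun hb => hb.1) (fun hb => absurd (hp.proper b e y β hyb hy hb.1 he) hbe)

/-- A fan at `x`: the edge `g 0` is uncolored, each `b (g i)` is available at the end of `g i`
other than `x`, and it is the color of `g (i + 1)`. -/
structure IsFan (ends : E → Sym2 V) (f : V → ℕ) (φ : E → Option ℕ) (x : V) (z : E → V)
    (b : E → ℕ) (g : ℕ → E) (k : ℕ) : Prop where
  zero : φ (g 0) = none
  ends_eq : ∀ i ≤ k, ends (g i) = s(x, z (g i))
  ne : ∀ i ≤ k, z (g i) ≠ x
  missing : ∀ i ≤ k, Missing ends f φ (z (g i)) (b (g i))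
  succ : ∀ i < k, φ (g (i + 1)) = some (b (g i))
  color_ne : ∀ i < k, ∀ j < i, b (g j) ≠ b (g i)
  parallel : ∀ i ≤ k, ∀ j ≤ k, z (g i) = z (g j) → b (g i) = b (g j) → g i = g j

open Classical in
/-- Give `b (g i)` to `g i` for all `i < j`, and uncolor `g j`. -/
noncomputable def fanShift (φ : E → Option ℕ) (b : E → ℕ) (g : ℕ → E) (j : ℕ) (a : E) :
    Option ℕ :=
  if a = g j then none else if ∃ i < j, a = g i then some (b a) else φ a

theorem fanShift_eq_some {φ : E → Option ℕ} {b : E → ℕ} {g : ℕ → E} {j : ℕ} {a : E} {c : ℕ}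
    (h : fanShift φ b g j a = some c) :
    a ≠ g j ∧ ((∃ i < j, a = g i ∧ b (g i) = c) ∨ φ a = some c) := by
  unfold fanShift at h
  split_ifs at h with h₁ h₂
  · obtain ⟨i, hi, rfl⟩ := h₂
    exact ⟨h₁, Or.inl ⟨i, hi, rfl, Option.some_inj.1 h⟩⟩
  · exact ⟨h₁, Or.inr h⟩

theorem fanShift_self (φ : E → Option ℕ) (b : E → ℕ) (g : ℕ → E) (j : ℕ) :
    fanShift φ b g j (g j) = none := by
  simp [fanShift]

namespace IsFan

variable {ends : E → Sym2 V} {f : V → ℕ} {φ : E → Option ℕ} {x : V} {z : E → V} {b : E → ℕ}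
  {g : ℕ → E} {k : ℕ}

theorem edge_ne (h : IsFan ends f φ x z b g k) {i j : ℕ} (hij : i < j) (hj : j ≤ k) :
    g i ≠ g j := by
  intro heq
  obtain ⟨j, rfl⟩ := Nat.exists_eq_add_of_lt (Nat.zero_lt_of_lt hij)
  have hj' := h.succ (0 + j) (by omega)
  rw [← heq] at hj'
  rcases i with - | i
  · rw [h.zero] at hj'
    cases hj'
  · rw [h.succ i (by omega), Option.some_inj] at hj'
    exact h.color_ne _ (by omega) i (by omega) hj'

theorem sees_of_fanShift (h : IsFan ends f φ x z b g k) {j : ℕ} (hj : j ≤ k) {c : ℕ}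
    (hs : Sees ends (fanShift φ b g j) x c) : Sees ends φ x c := by
  obtain ⟨a, ha, hxa⟩ := hs
  rcases (fanShift_eq_some ha).2 with ⟨i, hi, rfl, rfl⟩ | ha
  · exact ⟨g (i + 1), h.succ i (by omega), by simp [h.ends_eq (i + 1) (by omega)]⟩
  · exact ⟨a, ha, hxa⟩

theorem missing_fanShift (h : IsFan ends f φ x z b g k) {j : ℕ} (hj : j ≤ k) :
    Missing ends f (fanShift φ b g j) (z (g j)) (b (g j)) := by
  refine ⟨(h.missing j hj).1, (h.missing j hj).2.1, ?_⟩
  rintro ⟨a, ha, hza⟩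
  obtain ⟨hne, ⟨i, hi, rfl, hc⟩ | ha⟩ := fanShift_eq_some ha
  · rw [h.ends_eq i (by omega), Sym2.mem_iff] at hza
    rcases hza with hza | hza
    · exact h.ne j hj hza
    · exact hne (h.parallel i (by omega) j hj hza.symm hc)
  · exact (h.missing j hj).2.2 ⟨a, ha, hza⟩

theorem isOptimal_fanShift [Finite V] [Finite E] (h : IsFan ends f φ x z b g k)
    (hφ : IsOptimal ends f φ) {j : ℕ} (hj : j ≤ k) : IsOptimal ends f (fanShift φ b g j) := by
  classical
  induction j with
  | zero =>
    convert hφ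
    ext1 a
    by_cases ha : a = g 0
    · subst ha; simp [fanShift, h.zero]
    · simp [fanShift, ha]
  | succ j ih =>
    have hcol : fanShift φ b g j (g (j + 1)) = some (b (g j)) := by
      rw [fanShift, if_neg (h.edge_ne (Nat.lt_succ_self j) hj).symm, if_neg, h.succ j hj]
      rintro ⟨i, hi, heq⟩
      exact h.edge_ne (show i < j + 1 by omega) hj heq.symm
    convert (ih (by omega)).shift (fanShift_self φ b g j) (h.ends_eq j (by omega))
      (h.missing_fanShift (by omega)) (a := g (j + 1)) (by simp [h.ends_eq (j + 1) hj]) hcol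
    ext1 a
    simp only [Function.update_apply]
    by_cases h₁ : a = g (j + 1)
    · subst h₁
      simp [fanShift, (h.edge_ne (Nat.lt_succ_self j) hj).symm]
    by_cases h₂ : a = g j
    · subst h₂
      rw [if_pos rfl, fanShift, if_neg h₁, if_pos ⟨j, Nat.lt_succ_self j, rfl⟩]
    · simp only [fanShift, h₁, h₂, if_false]
      congr 1
      simp only [Nat.lt_succ_iff_lt_or_eq, eq_iff_iff]
      exact ⟨fun ⟨i, hi, heq⟩ => ⟨i, hi.resolve_right (by rintro rfl; exact h₂ heq), heq⟩,
        fun ⟨i, hi, heq⟩ => ⟨i, Or.inl hi, heq⟩⟩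

theorem sees [Finite V] [Finite E] (h : IsFan ends f φ x z b g k) (hφ : IsOptimal ends f φ) :
    Sees ends φ x (b (g k)) :=
  h.sees_of_fanShift le_rfl ((h.isOptimal_fanShift hφ le_rfl).sees_of_missing
    (fanShift_self φ b g k) (h.ends_eq k le_rfl) (h.missing_fanShift le_rfl))

theorem color_ne_last [Fintype V] [Finite E] (h : IsFan ends f φ x z b g k)
    (hφ : IsOptimal ends f φ) {α : ℕ} (hα : Missing ends f φ x α) {j : ℕ} (hj : j < k) :
    b (g j) ≠ b (g k) := by
  intro heq
  have hαb : ∀ i < k, α ≠ b (g i) := by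
    rintro i hi rfl
    exact hα.2.2 ⟨g (i + 1), h.succ i hi, by simp [h.ends_eq (i + 1) hi]⟩
  set β := b (g j) with hβ
  set M : Set E := {e | φ e = some α} with hM
  set N : Set E := {e | φ e = some β ∧ e ≠ g (j + 1)} with hN
  have hpM : IsMatching ends M := hφ.isPartialColoring.isMatching subset_rfl
  have hpN : IsMatching ends N := hφ.isPartialColoring.isMatching fun e he => he.1
  have hMx : ¬ Covers ends M x := hα.2.2
  have hNx : ¬ Covers ends N x := by
    rintro ⟨e, he, hxe⟩
    exact he.2 (hφ.isPartialColoring.proper e _ x β hxe (by simp [h.ends_eq (j + 1) hj]) he.1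
      (h.succ j hj))
  have hαi : ∀ i ≤ k, Missing ends f (fanShift φ b g i) x α :=
    fun i hi => ⟨hα.1, hα.2.1, fun hs => hα.2.2 (h.sees_of_fanShift hi hs)⟩
  have hMi : ∀ i ≤ k, {e | fanShift φ b g i e = some α} ⊆ M := by
    intro i hi e he
    rcases (fanShift_eq_some he).2 with ⟨i', hi', -, hc⟩ | he
    · exact absurd hc.symm (hαb i' (by omega))
    · exact he
  have hNj : {e | fanShift φ b g j e = some β} ⊆ insert (g (j + 1)) N := by
    intro e he
    rcases (fanShift_eq_some he).2 with ⟨i', hi', -, hc⟩ | he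
    · exact absurd hc (h.color_ne j hj i' hi')
    · by_cases hej : e = g (j + 1)
      · exact Or.inl hej
      · exact Or.inr ⟨he, hej⟩
  have hNk : {e | fanShift φ b g k e = some β} ⊆ insert (g j) N := by
    intro e he
    obtain ⟨hek, ⟨i', hi', rfl, hc⟩ | hφe⟩ := fanShift_eq_some he
    · rcases lt_trichotomy i' j with hlt | rfl | hlt
      · exact absurd hc (h.color_ne j hj i' hlt)
      · exact Or.inl rfl
      · exact absurd hc.symm (h.color_ne i' hi' j hlt)
    · refine Or.inr ⟨hφe, ?_⟩
      rintro rfl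
      rcases Nat.lt_or_ge (j + 1) k with hlt | hge
      · have : fanShift φ b g k (g (j + 1)) = some (b (g (j + 1))) := by
          rw [fanShift, if_neg hek, if_pos ⟨j + 1, hlt, rfl⟩]
        rw [show fanShift φ b g k (g (j + 1)) = some β from he, Option.some_inj] at this
        exact h.color_ne (j + 1) hlt j (by omega) this
      · exact hek (by rw [show j + 1 = k by omega])
  have rj : (unionGraph ends M N).Reachable (z (g (j + 1))) (z (g j)) := by
    refine reachable_of_insert (h.ends_eq (j + 1) hj) hMx hNx (h.ne j hj.le) ?_
    exact SimpleGraph.Reachable.mono (unionGraph_mono (hMi j hj.le) hNj)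
      ((h.isOptimal_fanShift hφ hj.le).reachable (fanShift_self φ b g j) (h.ends_eq j hj.le)
        (hαi j hj.le) (h.missing_fanShift hj.le))
  have rk : (unionGraph ends M N).Reachable (z (g j)) (z (g k)) := by
    refine reachable_of_insert (h.ends_eq j hj.le) hMx hNx (h.ne k le_rfl) ?_
    exact SimpleGraph.Reachable.mono (unionGraph_mono (hMi k le_rfl) hNk)
      ((h.isOptimal_fanShift hφ le_rfl).reachable (fanShift_self φ b g k) (h.ends_eq k le_rfl)
        (hαi k le_rfl) (heq ▸ h.missing_fanShift le_rfl))
  have hsj : ¬ Sees ends φ (z (g j)) β := (h.missing j hj.le).2.2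
  have hsk : ¬ Sees ends φ (z (g k)) β := heq ▸ (h.missing k le_rfl).2.2
  have hss : Sees ends φ (z (g (j + 1))) β :=
    ⟨g (j + 1), h.succ j hj, by simp [h.ends_eq (j + 1) hj]⟩
  have hNend : ∀ v, ¬ Sees ends φ v β → ¬ (Covers ends M v ∧ Covers ends N v) := by
    rintro v hv ⟨-, e, he, hve⟩
    exact hv ⟨e, he.1, hve⟩
  refine unionGraph_not_reachable hpM hpN (a := z (g (j + 1))) (b := z (g j)) (c := z (g k))
    ?_ (hNend _ hsj) (hNend _ hsk) ?_ ?_ ?_ rj (rj.trans rk)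
  · rintro ⟨-, e, he, hve⟩
    exact he.2 (hφ.isPartialColoring.proper e _ _ β hve (by simp [h.ends_eq (j + 1) hj]) he.1
      (h.succ j hj))
  · exact fun h' => hsj (h' ▸ hss)
  · exact fun h' => hsk (h' ▸ hss)
  · exact fun h' => h.edge_ne hj le_rfl (h.parallel j hj.le k le_rfl h' heq)

end IsFan

/-- If every vertex has at least as many available colors as parallel edges to any other vertex,
then an optimal coloring colors all edges. -/
theorem IsOptimal.ne_none [Fintype V] [Finite E] {ends : E → Sym2 V} {f : V → ℕ}
    {φ : E → Option ℕ} (hφ : IsOptimal ends f φ) (hloop : ∀ e, ¬ (ends e).IsDiag)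
    (hcard : ∀ x y, edgeMultiplicity ends x y ≤ {c | Missing ends f φ y c}.ncard) (e : E) :
    φ e ≠ none := by
  classical
  intro he
  obtain ⟨x, y, hxy⟩ : ∃ x y, ends e = s(x, y) := ⟨_, _, (Quot.out_eq (ends e)).symm⟩
  have hfin : ∀ y, {c | Missing ends f φ y c}.Finite :=
    fun y => (Set.finite_Iic (f y)).subset fun c hc => hc.2.1
  have hinj : ∀ y, ∃ F : {e // ends e = s(x, y)} → ℕ, Function.Injective F ∧
      ∀ e, Missing ends f φ y (F e) := by
    intro y
    have := Fintype.ofFinite {e // ends e = s(x, y)}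
    have := (hfin y).fintype
    have hle : Nat.card {e // ends e = s(x, y)} ≤ Nat.card {c | Missing ends f φ y c} := hcard x y
    rw [Nat.card_eq_fintype_card, Nat.card_eq_fintype_card] at hle
    obtain ⟨F⟩ := Function.Embedding.nonempty_of_card_le hle
    exact ⟨fun e => F e, fun a b hab => F.injective (Subtype.ext hab), fun e => (F e).2⟩
  choose F hF hFm using hinj
  obtain ⟨α, hα⟩ : ∃ α, Missing ends f φ x α := by
    have : 0 < edgeMultiplicity ends y x := by
      have : Nonempty {e // ends e = s(y, x)} := ⟨e, hxy.trans Sym2.eq_swap⟩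
      exact Nat.card_pos
    exact (Set.ncard_pos (hfin x)).1 (this.trans_le (hcard y x))
  have hz : ∀ a, ∃ w, x ∈ ends a → ends a = s(x, w) := by
    intro a
    by_cases hxa : x ∈ ends a
    · obtain ⟨w, hw⟩ := hxa
      exact ⟨w, fun _ => hw⟩
    · exact ⟨x, fun h => absurd h hxa⟩
  choose z hz using hz
  let b : E → ℕ := fun a => if ha : ends a = s(x, z a) then F (z a) ⟨a, ha⟩ else 0
  have hb : ∀ a (ha : ends a = s(x, z a)), b a = F (z a) ⟨a, ha⟩ := fun a ha => dif_pos ha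
  have hnxt : ∀ a, ∃ a', x ∈ ends a' ∧
      ((∃ a'', x ∈ ends a'' ∧ φ a'' = some (b a)) → φ a' = some (b a)) := by
    intro a
    by_cases h : ∃ a'', x ∈ ends a'' ∧ φ a'' = some (b a)
    · obtain ⟨a', ha'⟩ := h
      exact ⟨a', ha'.1, fun _ => ha'.2⟩
    · exact ⟨e, by simp [hxy], fun h' => absurd h' h⟩
  choose nxt hnxt_mem hnxt using hnxt
  let g : ℕ → E := fun i => nxt^[i] e
  have hg_succ : ∀ i, g (i + 1) = nxt (g i) := fun i => Function.iterate_succ_apply' nxt i e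
  have hg_mem : ∀ i, x ∈ ends (g i) := by
    rintro (- | i)
    · change x ∈ ends e
      simp [hxy]
    · rw [hg_succ]; exact hnxt_mem _
  have hg_ends : ∀ i, ends (g i) = s(x, z (g i)) := fun i => hz _ (hg_mem i)
  have hQ : ∃ k, ¬ Sees ends φ x (b (g k)) ∨ ∃ j < k, b (g j) = b (g k) := by
    obtain ⟨i, j, hij, heq⟩ := Finite.exists_ne_map_eq_of_infinite g
    rcases lt_or_gt_of_ne hij with h | h
    · exact ⟨j, Or.inr ⟨i, h, by rw [heq]⟩⟩
    · exact ⟨i, Or.inr ⟨j, h, by rw [heq]⟩⟩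
  have hfan : IsFan ends f φ x z b g (Nat.find hQ) := by
    have hmin : ∀ i < Nat.find hQ, Sees ends φ x (b (g i)) ∧ ∀ j < i, b (g j) ≠ b (g i) := by
      intro i hi
      have := Nat.find_min hQ hi
      push Not at this
      exact this
    refine ⟨he, fun i _ => hg_ends i, fun i _ heq => hloop (g i) ?_, fun i _ => ?_, fun i hi => ?_,
      fun i hi => (hmin i hi).2, fun i _ j _ hzz hbb => ?_⟩
    · rw [hg_ends i, heq]; exact rfl
    · rw [hb _ (hg_ends i)]; exact hFm _ _
    · rw [hg_succ]
      obtain ⟨a, ha, hxa⟩ := (hmin i hi).1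
      exact hnxt (g i) ⟨a, hxa, ha⟩
    · have key : ∀ a a' (ha : ends a = s(x, z a)) (ha' : ends a' = s(x, z a')), z a = z a' →
          b a = b a' → a = a' := by
        intro a a' ha ha' hzz hbb
        rw [hb a ha, hb a' ha'] at hbb
        have h' : ends a = s(x, z a') := hzz ▸ ha
        have : F (z a) ⟨a, ha⟩ = F (z a') ⟨a, h'⟩ := by congr!
        exact congrArg Subtype.val (hF _ (this.symm.trans hbb))
      exact key _ _ (hg_ends i) (hg_ends j) hzz hbb
  rcases Nat.find_spec hQ with hk | ⟨j, hj, heq⟩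
  · exact hk (hfan.sees hφ)
  · exact hfan.color_ne_last hφ hα hj heq

/-- The number of colors available at `v` is at least the surplus of `f v` over the degree. -/
theorem le_ncard_missing [Finite E] (ends : E → Sym2 V) (f : V → ℕ) (φ : E → Option ℕ) (v : V) :
    f v ≤ multideg ends v + {c | Missing ends f φ v c}.ncard := by
  have hfin : {c | Missing ends f φ v c}.Finite :=
    (Set.finite_Iic (f v)).subset fun c hc => hc.2.1
  let D : Set ℕ := (fun e => (φ e).getD 0) '' {e | v ∈ ends e}
  have hsub : Set.Icc 1 (f v) ⊆ D ∪ {c | Missing ends f φ v c} := by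
    intro c hc
    by_cases hs : Sees ends φ v c
    · obtain ⟨e, he, hve⟩ := hs
      exact Or.inl ⟨e, hve, by simp [show φ e = some c from he]⟩
    · exact Or.inr ⟨hc.1, hc.2, hs⟩
  have h₁ := Set.ncard_le_ncard hsub ((Set.toFinite D).union hfin)
  have h₂ := Set.ncard_union_le D {c | Missing ends f φ v c}
  have h₃ : D.ncard ≤ multideg ends v := Set.ncard_image_le
  have h₄ : (Set.Icc 1 (f v)).ncard = f v := by
    rw [← Finset.coe_Icc, Set.ncard_coe_finset, Nat.card_Icc]
    omega
  omega

end LocalVizing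

/-- **Local Vizing theorem.** Every finite loopless multigraph has a proper
edge-coloring `φ` such that every edge `e` with endpoints `x, y` satisfies
`φ(e) ∈ {1, …, max{deg(x) + μ(x), deg(y) + μ(y)}}`. -/
theorem local_vizing_edge_coloring {V E : Type} [Fintype V] [Fintype E]
    (ends : E → Sym2 V) (hloopless : ∀ e : E, ¬ (ends e).IsDiag) :
    ∃ φ : E → ℕ, IsProperEdgeColoring ends φ ∧
      ∀ (e : E) (x y : V), ends e = s(x, y) →
        φ e ∈ Finset.Icc 1
          (max (multideg ends x + maxMultiplicity ends x)
               (multideg ends y + maxMultiplicity ends y)) := by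
  let f : V → ℕ := fun v => multideg ends v + maxMultiplicity ends v
  obtain ⟨φ, hφ⟩ := LocalVizing.exists_isOptimal ends f
  have hcard : ∀ x y, edgeMultiplicity ends x y ≤
      {c | LocalVizing.Missing ends f φ y c}.ncard := by
    intro x y
    have h₁ : edgeMultiplicity ends y x ≤ maxMultiplicity ends y :=
      Finset.le_sup (f := fun z => edgeMultiplicity ends y z) (Finset.mem_univ x)
    have h₂ : edgeMultiplicity ends x y = edgeMultiplicity ends y x := by
      simp only [edgeMultiplicity, Sym2.eq_swap (a := x) (b := y)]
    have h₃ : multideg ends y + maxMultiplicity ends y ≤ _ :=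
      LocalVizing.le_ncard_missing ends f φ y
    omega
  have hsome := fun e => Option.ne_none_iff_exists'.1 (hφ.ne_none hloopless hcard e)
  choose ψ hψ using hsome
  refine ⟨ψ, ?_, fun e x y he => ?_⟩
  · rintro e e' hne ⟨v, hv, hv'⟩ heq
    exact hne (hφ.isPartialColoring.proper e e' v (ψ e) hv hv' (hψ e) (heq ▸ hψ e'))
  · obtain ⟨v, hv, hle⟩ := hφ.isPartialColoring.bound e _ (hψ e)
    rw [Finset.mem_Icc, le_max_iff]
    refine ⟨hφ.isPartialColoring.pos e _ (hψ e), ?_⟩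
    rw [he, Sym2.mem_iff] at hv
    rcases hv with rfl | rfl
    · exact Or.inl hle
    · exact Or.inr hle
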